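/- Let T>0, let b∈C¹([0,T]) be nonnegative, let a∈𝒢^s(ℝ) (s>1) be nonnegative and let 0≤δ<1; write ∂_tΛ(t,x,ξ)=|b'(t)|φ(x,ξ)/(b(t)φ(x,ξ)+⟨ξ⟩_μ^{-2δ}). Then there exist A>0 and C>0, independent of μ∈(0,1] and t∈[0,T], such that for all k,l∈ℕ, x,ξ∈ℝ, t∈[0,T] and 0<μ≤1: |∂_x^{k}∂_ξ^{l}∂_tΛ(t,x,ξ)| ≤ C·A^{k+l}·(k+l)!·(1+(k+l)^{s-1}⟨ξ⟩_μ^{-δ})^{k+l}·∂_tΛ(t,x,ξ)·⟨ξ⟩_μ^{-l+δk}. -/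

import Mathlib

open scoped ContDiff

open Set

/-- `⟨ξ⟩_μ = (μ⁻² + ξ²)^(1/2)` -/
noncomputable def br (μ ξ : ℝ) : ℝ := Real.sqrt (μ⁻¹ ^ 2 + ξ ^ 2)

/-- `φ(x,ξ) = a(x) + ⟨ξ⟩_μ^(-2δ)` -/
noncomputable def phi (a : ℝ → ℝ) (δ μ x ξ : ℝ) : ℝ := a x + br μ ξ ^ (-(2*δ))

/-- Gevrey class `𝒢^s(ℝ)` -/
def Gevrey (s : ℝ) (a : ℝ → ℝ) : Prop :=
  ContDiff ℝ ∞ a ∧ ∃ C₀ A₀ : ℝ, 0 < C₀ ∧ 0 < A₀ ∧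
    ∀ (x : ℝ) (k : ℕ), |iteratedDeriv k a x| ≤ C₀ * A₀ ^ k * (k.factorial : ℝ) ^ s

/-- `∂_x^k ∂_ξ^l f(x,ξ)` -/
noncomputable def pdXxi (k l : ℕ) (f : ℝ → ℝ → ℝ) (x ξ : ℝ) : ℝ :=
  iteratedDeriv k (fun x' => iteratedDeriv l (f x') ξ) x

/-- `∂_tΛ(t,x,ξ) = |b'(t)| φ(x,ξ) / (b(t) φ(x,ξ) + ⟨ξ⟩_μ^(-2δ))`,
with `b'` the derivative of `b` within `[0,T]`. -/
noncomputable def dtLam (b a : ℝ → ℝ) (T δ μ t x ξ : ℝ) : ℝ :=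
  |derivWithin b (Icc 0 T) t| * phi a δ μ x ξ /
    (b t * phi a δ μ x ξ + br μ ξ ^ (-(2*δ)))

/-- smoothness of partial ξ-derivatives -/
lemma smooth_pd (f : ℝ → ℝ → ℝ) (hf : ContDiff ℝ ∞ (fun p : ℝ × ℝ => f p.1 p.2)) (l : ℕ) :
    ContDiff ℝ ∞ (fun p : ℝ × ℝ => iteratedDeriv l (f p.1) p.2) := by
  induction l with
  | zero => simpa using hf
  | succ l ih =>
    have h1 : (fun p : ℝ × ℝ => iteratedDeriv (l+1) (f p.1) p.2) =
        fun p : ℝ × ℝ => fderiv ℝ (fun p : ℝ × ℝ => iteratedDeriv l (f p.1) p.2) p (0, 1) := by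
      funext p
      rw [iteratedDeriv_succ]
      have hd : HasFDerivAt (fun p : ℝ × ℝ => iteratedDeriv l (f p.1) p.2)
        (fderiv ℝ (fun p : ℝ × ℝ => iteratedDeriv l (f p.1) p.2) p) (p.1, p.2) :=
        (ih.differentiable (by simp) p).hasFDerivAt
      have h2 : HasDerivAt (fun y : ℝ => ((p.1, y) : ℝ × ℝ)) ((0:ℝ), (1:ℝ)) p.2 :=
        (hasDerivAt_const p.2 p.1).prodMk (hasDerivAt_id p.2)
      have h3 := hd.comp_hasDerivAt p.2 h2
      exact h3.deriv
    rw [h1]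
    exact (ih.fderiv_right (m := ∞) (by simp)).clm_apply contDiff_const

lemma smooth_pd_x (f : ℝ → ℝ → ℝ) (hf : ContDiff ℝ ∞ (fun p : ℝ × ℝ => f p.1 p.2)) (l : ℕ)
    (ξ : ℝ) : ContDiff ℝ ∞ (fun x : ℝ => iteratedDeriv l (f x) ξ) :=
  (smooth_pd f hf l).comp (contDiff_id.prodMk contDiff_const)

lemma smooth_sec (f : ℝ → ℝ → ℝ) (hf : ContDiff ℝ ∞ (fun p : ℝ × ℝ => f p.1 p.2)) 
    (x : ℝ) : ContDiff ℝ ∞ (f x) :=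
  hf.comp (contDiff_const.prodMk contDiff_id)

lemma pd_mul (f g : ℝ → ℝ → ℝ) (hf : ContDiff ℝ ∞ (fun p : ℝ × ℝ => f p.1 p.2))
    (hg : ContDiff ℝ ∞ (fun p : ℝ × ℝ => g p.1 p.2)) (k l : ℕ) (x ξ : ℝ) :
    pdXxi k l (fun x ξ => f x ξ * g x ξ) x ξ =
      ∑ i ∈ Finset.range (k+1), ∑ j ∈ Finset.range (l+1),
        (k.choose i : ℝ) * (l.choose j : ℝ) * (pdXxi i j f x ξ * pdXxi (k-i) (l-j) g x ξ) := by
  unfold pdXxi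
  have h1 : (fun x' => iteratedDeriv l (fun ξ => f x' ξ * g x' ξ) ξ) = fun x' =>
      ∑ j ∈ Finset.range (l+1), (l.choose j : ℝ) *
        (iteratedDeriv j (f x') ξ * iteratedDeriv (l-j) (g x') ξ) := by
    funext x'
    have := iteratedDeriv_fun_mul (n := l) (x := ξ) ((smooth_sec f hf x').of_le (by exact_mod_cast le_top)).contDiffAt
      ((smooth_sec g hg x').of_le (by exact_mod_cast le_top)).contDiffAt
    rw [this]
    simp only [mul_assoc]
  rw [h1, iteratedDeriv_fun_sum]
  · rw [Finset.sum_comm]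
    refine Finset.sum_congr rfl fun j _ => ?_
    rw [iteratedDeriv_const_mul_field]
    have := iteratedDeriv_fun_mul (n := k) (x := x) ((smooth_pd_x f hf j ξ).of_le (by exact_mod_cast le_top)).contDiffAt
      ((smooth_pd_x g hg (l-j) ξ).of_le (by exact_mod_cast le_top)).contDiffAt
    rw [this, Finset.mul_sum]
    refine Finset.sum_congr rfl fun i _ => ?_
    ring
  · intro j _
    exact ((contDiff_const.mul ((smooth_pd_x f hf j ξ).mul (smooth_pd_x g hg (l-j) ξ))).of_le
      (by exact_mod_cast le_top)).contDiffAt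

lemma pd_add (f g : ℝ → ℝ → ℝ) (hf : ContDiff ℝ ∞ (fun p : ℝ × ℝ => f p.1 p.2))
    (hg : ContDiff ℝ ∞ (fun p : ℝ × ℝ => g p.1 p.2)) (k l : ℕ) (x ξ : ℝ) :
    pdXxi k l (fun x ξ => f x ξ + g x ξ) x ξ = pdXxi k l f x ξ + pdXxi k l g x ξ := by
  unfold pdXxi
  have h1 : (fun x' => iteratedDeriv l (fun ξ => f x' ξ + g x' ξ) ξ) = fun x' =>
      iteratedDeriv l (f x') ξ + iteratedDeriv l (g x') ξ := by
    funext x'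
    exact iteratedDeriv_fun_add ((smooth_sec f hf x').of_le (by exact_mod_cast le_top)).contDiffAt
      ((smooth_sec g hg x').of_le (by exact_mod_cast le_top)).contDiffAt
  rw [h1]
  exact iteratedDeriv_fun_add ((smooth_pd_x f hf l ξ).of_le (by exact_mod_cast le_top)).contDiffAt
      ((smooth_pd_x g hg l ξ).of_le (by exact_mod_cast le_top)).contDiffAt

lemma pd_const_mul (c : ℝ) (f : ℝ → ℝ → ℝ) (k l : ℕ) (x ξ : ℝ) :
    pdXxi k l (fun x ξ => c * f x ξ) x ξ = c * pdXxi k l f x ξ := by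
  simp [pdXxi]

lemma pd_one_add (a g : ℝ → ℝ) (k l : ℕ) (x ξ : ℝ) (h : 0 < k + l) :
    pdXxi k l (fun x ξ => 1 + a x * g ξ) x ξ = iteratedDeriv k a x * iteratedDeriv l g ξ := by
  unfold pdXxi
  rcases Nat.eq_zero_or_pos l with rfl | hl
  · simp only [iteratedDeriv_zero]
    rw [iteratedDeriv_const_add (by omega), iteratedDeriv_mul_const_field]
  · have : (fun x' => iteratedDeriv l (fun ξ => 1 + a x' * g ξ) ξ) =
        fun x' => a x' * iteratedDeriv l g ξ := by
      funext x'
      rw [iteratedDeriv_const_add hl, iteratedDeriv_const_mul_field]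
    rw [this, iteratedDeriv_mul_const_field]

/-- geometric sum bound -/
lemma geom_bd (K : ℝ) (hK : 8 ≤ K) (k : ℕ) :
    (∑ i ∈ Finset.range (k+1), K^i) * (K - 1) ≤ K^k * K := by
  rw [geom_sum_mul, pow_succ]; linarith

lemma geom_bd2 (K : ℝ) (hK : 8 ≤ K) (k l : ℕ) :
    (∑ i ∈ Finset.range (k+1), ∑ j ∈ Finset.range (l+1), K^(i+j)) ≤ K^(k+l) * (1 + 4 / K) := by
  have h1 := geom_bd K hK k
  have h2 := geom_bd K hK l
  have e : (∑ i ∈ Finset.range (k+1), ∑ j ∈ Finset.range (l+1), K^(i+j)) =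
    (∑ i ∈ Finset.range (k+1), K^i) * (∑ j ∈ Finset.range (l+1), K^j) := by
    rw [Finset.sum_mul_sum]; simp only [pow_add]
  rw [e]
  have p1 : 0 < K - 1 := by linarith
  have hS : 0 ≤ ∑ j ∈ Finset.range (l+1), K^j := Finset.sum_nonneg fun i _ => by positivity
  have h3 := mul_le_mul h1 h2 (by positivity) (by positivity)
  have h4 : (K * K) ≤ (1 + 4/K) * ((K-1)*(K-1)) := by
    have hK0 : 0 < K := by linarith
    rw [show (1 + 4/K) = (K+4)/K by field_simp, div_mul_eq_mul_div, le_div_iff₀ hK0]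
    nlinarith
  have h5 : K^(k+l) * (K*K) ≤ K^(k+l) * ((1 + 4/K) * ((K-1)*(K-1))) := by gcongr
  rw [pow_add] at *
  have p2 : 0 < (K-1)*(K-1) := by positivity
  refine le_of_mul_le_mul_right ?_ p2
  nlinarith

/-- the recursion -/
lemma rec_bd (F G : ℕ → ℕ → ℝ) (b C X Y : ℝ) (N : ℕ) (hb : 0 ≤ b) (hC : 1 ≤ C)
    (hX : 0 ≤ X) (hY : 0 ≤ Y) (hF0 : 0 < F 0 0) (hG0 : 0 < G 0 0)
    (hG : ∀ i j, i + j ≤ N → |G i j| ≤ C * X^i * Y^j * (i.factorial * j.factorial) * G 0 0)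
    (hrec : ∀ k l, F k l + b * ∑ i ∈ Finset.range (k+1), ∑ j ∈ Finset.range (l+1),
        (k.choose i : ℝ) * (l.choose j : ℝ) * (F i j * G (k-i) (l-j)) = G k l) :
    ∀ k l, k + l ≤ N →
      |F k l| ≤ X^k * Y^l * (8*C)^(k+l) * (k.factorial * l.factorial) * F 0 0 := by
  suffices H : ∀ n k l, k + l = n → n ≤ N →
      |F k l| ≤ X^k * Y^l * (8*C)^(k+l) * (k.factorial * l.factorial) * F 0 0 from
    fun k l h => H _ k l rfl h
  intro n
  induction n using Nat.strong_induction_on with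
  | _ n ih =>
  intro k l hkl hn
  have h00 : G 0 0 = F 0 0 * (1 + b * G 0 0) := by
    have := hrec 0 0
    simp at this
    linarith
  rcases Nat.eq_zero_or_pos n with rfl | hpos
  · obtain ⟨rfl, rfl⟩ : k = 0 ∧ l = 0 := by omega
    simp [abs_of_pos hF0]
  set K := 8 * C with hK
  have hK8 : 8 ≤ K := by linarith
  set S := Finset.range (k+1) ×ˢ Finset.range (l+1) with hS
  have hr := hrec k l
  rw [← Finset.sum_product', ← hS] at hr
  have hmem : (k, l) ∈ S := by simp [hS]
  rw [← Finset.add_sum_erase S _ hmem] at hr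
  simp only [Nat.choose_self, Nat.sub_self, Nat.cast_one, one_mul] at hr
  have hgeo := geom_bd2 K hK8 k l
  rw [← Finset.sum_product', ← hS, ← Finset.add_sum_erase S _ hmem] at hgeo
  simp only at hgeo
  set Sg := ∑ p ∈ S.erase (k,l), K^(p.1+p.2) with hSg
  have hSg1 : 1 ≤ Sg := by
    have : (0,0) ∈ S.erase (k,l) := by
      simp [hS]; omega
    have := Finset.single_le_sum (f := fun p : ℕ × ℕ => K^(p.1+p.2)) (fun p _ => by positivity) this
    simpa using this
  set E := ∑ p ∈ S.erase (k,l), (k.choose p.1 : ℝ) * (l.choose p.2 : ℝ) * (F p.1 p.2 * G (k-p.1) (l-p.2)) with hE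
  have hEb : |E| ≤ C * X^k * Y^l * (k.factorial * l.factorial) * F 0 0 * G 0 0 * Sg := by
    rw [hE, hSg, Finset.mul_sum]
    refine (Finset.abs_sum_le_sum_abs _ _).trans (Finset.sum_le_sum ?_)
    rintro ⟨i, j⟩ hp
    simp only [hS, Finset.mem_erase, Finset.mem_product, Finset.mem_range, ne_eq, Prod.mk.injEq] at hp
    simp only
    have hi : i ≤ k := by omega
    have hj : j ≤ l := by omega
    have h1 := ih (i+j) (by omega) i j rfl (by omega)
    have h2 := hG (k-i) (l-j) (by omega)
    rw [abs_mul, abs_mul (F i j), abs_of_nonneg (by positivity : (0:ℝ) ≤ (k.choose i : ℝ) * (l.choose j : ℝ))]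
    have c1 : (k.choose i : ℝ) * i.factorial * (k-i).factorial = k.factorial := by
      exact_mod_cast Nat.choose_mul_factorial_mul_factorial hi
    have c2 : (l.choose j : ℝ) * j.factorial * (l-j).factorial = l.factorial := by
      exact_mod_cast Nat.choose_mul_factorial_mul_factorial hj
    have x1 : X^k = X^i * X^(k-i) := by rw [← pow_add]; congr 1; omega
    have y1 : Y^l = Y^j * Y^(l-j) := by rw [← pow_add]; congr 1; omega
    calc _ ≤ (k.choose i : ℝ) * (l.choose j : ℝ) * 
          ((X^i * Y^j * K^(i+j) * (i.factorial * j.factorial) * F 0 0) *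
           (C * X^(k-i) * Y^(l-j) * ((k-i).factorial * (l-j).factorial) * G 0 0)) := by
          gcongr
      _ = _ := by rw [← c1, ← c2, x1, y1]; ring
  have hGkl := hG k l (by omega)
  have hD : 0 < 1 + b * G 0 0 := by positivity
  have hmain : |F k l| * (1 + b * G 0 0) ≤ |G k l| + b * |E| := by
    have e1 : F k l * (1 + b * G 0 0) = G k l - b * E := by rw [← hr]; ring
    have e2 : |F k l| * (1 + b * G 0 0) = |G k l - b * E| := by
      rw [← e1, abs_mul, abs_of_pos hD]
    rw [e2]
    refine (abs_sub _ _).trans ?_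
    rw [abs_mul, abs_of_nonneg hb]
  set W := X^k * Y^l * (k.factorial * l.factorial) with hW
  have hW0 : 0 ≤ W := by positivity
  have hS2 : C * (1 + Sg) ≤ K^(k+l) := by
    have : Sg ≤ K^(k+l) * (4/K) := by linarith
    have h8 : C * (2 * (K^(k+l) * (4/K))) = K^(k+l) := by
      have : K ≠ 0 := by linarith
      have hC8 : C = K / 8 := by rw [hK]; ring
      rw [hC8]; field_simp; norm_num
    rw [← h8]
    have : 1 + Sg ≤ 2 * (K^(k+l) * (4/K)) := by linarith
    gcongr
  have hfin : |F k l| * (1 + b * G 0 0) ≤ (W * K^(k+l) * F 0 0) * (1 + b * G 0 0) := by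
    calc _ ≤ C * W * G 0 0 + b * (C * W * F 0 0 * G 0 0 * Sg) := by
          refine hmain.trans ?_
          have : C * X^k * Y^l * (k.factorial * l.factorial) * G 0 0 = C * W * G 0 0 := by rw [hW]; ring
          rw [this] at hGkl
          have : C * X^k * Y^l * (k.factorial * l.factorial) * F 0 0 * G 0 0 * Sg = C * W * F 0 0 * G 0 0 * Sg := by rw [hW]; ring
          rw [this] at hEb
          gcongr
      _ = C * W * G 0 0 + (C * W * F 0 0 * Sg) * (b * G 0 0) := by ring
      _ ≤ C * W * (F 0 0 * (1 + b * G 0 0)) + (C * W * F 0 0 * Sg) * (1 + b * G 0 0) := by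
          rw [← h00]
          have : b * G 0 0 ≤ 1 + b * G 0 0 := by linarith
          exact add_le_add le_rfl (mul_le_mul_of_nonneg_left this (mul_nonneg
            (mul_nonneg (mul_nonneg (by linarith) hW0) hF0.le) (by linarith)))
      _ = W * (C * (1 + Sg)) * F 0 0 * (1 + b * G 0 0) := by ring
      _ ≤ W * (K^(k+l)) * F 0 0 * (1 + b * G 0 0) :=
          mul_le_mul_of_nonneg_right (mul_le_mul_of_nonneg_right
            (mul_le_mul_of_nonneg_left hS2 hW0) hF0.le) hD.le
  have := le_of_mul_le_mul_right hfin hD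
  calc _ ≤ _ := this
    _ = _ := by rw [hW]; ring
/-- `g(ξ) = (m² + ξ²)^δ` -/
noncomputable def gg (m δ ξ : ℝ) : ℝ := (m ^ 2 + ξ ^ 2) ^ δ

lemma q_pos (m ξ : ℝ) (hm : 0 < m) : 0 < m^2 + ξ^2 := by positivity

lemma gg_smooth (m δ : ℝ) (hm : 0 < m) : ContDiff ℝ ∞ (gg m δ) := by
  unfold gg
  exact ContDiff.rpow_const_of_ne (by fun_prop) fun x => (q_pos m x hm).ne'

lemma gg_pos (m δ ξ : ℝ) (hm : 0 < m) : 0 < gg m δ ξ := Real.rpow_pos_of_pos (q_pos m ξ hm) _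

lemma gg_hd (m δ : ℝ) (hm : 0 < m) (n : ℕ) (ξ : ℝ) :
    HasDerivAt (iteratedDeriv n (gg m δ)) (iteratedDeriv (n+1) (gg m δ) ξ) ξ := by
  rw [iteratedDeriv_succ]
  have : ContDiff ℝ (n+1 : ℕ) (gg m δ) := (gg_smooth m δ hm).of_le (by exact_mod_cast le_top)
  exact ((this.differentiable_iteratedDeriv n (by exact_mod_cast Nat.lt_succ_self n)) ξ).hasDerivAt

lemma gg_rec0 (m δ : ℝ) (hm : 0 < m) (ξ : ℝ) :
    (m^2+ξ^2) * iteratedDeriv 1 (gg m δ) ξ = 2 * δ * ξ * gg m δ ξ := by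
  have hq := q_pos m ξ hm
  have h1 : HasDerivAt (fun y : ℝ => m^2 + y^2) (2*ξ) ξ := by
    simpa using (hasDerivAt_pow 2 ξ).const_add (m^2)
  have h2 := h1.rpow_const (p := δ) (Or.inl hq.ne')
  have h3 : iteratedDeriv 1 (gg m δ) ξ = 2 * ξ * δ * (m^2+ξ^2)^(δ-1) := by
    rw [iteratedDeriv_one]; exact h2.deriv
  rw [h3, gg, Real.rpow_sub_one hq.ne']
  field_simp

lemma gg_rec (m δ : ℝ) (hm : 0 < m) (l : ℕ) : ∀ ξ : ℝ,
    (m^2+ξ^2) * iteratedDeriv (l+2) (gg m δ) ξ + 2 * (l+1) * (ξ * iteratedDeriv (l+1) (gg m δ) ξ)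
      + l * (l+1) * iteratedDeriv l (gg m δ) ξ =
    2 * δ * (ξ * iteratedDeriv (l+1) (gg m δ) ξ + (l+1) * iteratedDeriv l (gg m δ) ξ) := by
  have hq : ∀ ξ, HasDerivAt (fun y : ℝ => m^2 + y^2) (2*ξ) ξ := fun ξ => by
    simpa using (hasDerivAt_pow 2 ξ).const_add (m^2)
  induction l with
  | zero =>
    intro ξ
    have e : (fun ξ => (m^2+ξ^2) * iteratedDeriv 1 (gg m δ) ξ) =
      fun ξ => 2 * δ * (ξ * iteratedDeriv 0 (gg m δ) ξ) := by
      funext ξ; rw [gg_rec0 m δ hm, iteratedDeriv_zero]; ring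
    have d1 := (hq ξ).mul (gg_hd m δ hm 1 ξ)
    have d2 := ((hasDerivAt_id' ξ).mul (gg_hd m δ hm 0 ξ)).const_mul (2*δ)
    have d1' : HasDerivAt (fun ξ => (m^2+ξ^2) * iteratedDeriv 1 (gg m δ) ξ) _ ξ := d1
    rw [e] at d1'
    have := d1'.unique d2
    simp only [zero_add, Nat.reduceAdd, Nat.cast_zero] at this ⊢
    linarith
  | succ l ih =>
    intro ξ
    have e := funext ih
    have d1 := (((hq ξ).mul (gg_hd m δ hm (l+2) ξ)).add
      (((hasDerivAt_id' ξ).mul (gg_hd m δ hm (l+1) ξ)).const_mul (2*((l:ℝ)+1)))).add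
        ((gg_hd m δ hm l ξ).const_mul ((l:ℝ) * (l+1)))
    have d2 := (((hasDerivAt_id' ξ).mul (gg_hd m δ hm (l+1) ξ)).add
      ((gg_hd m δ hm l ξ).const_mul ((l:ℝ)+1))).const_mul (2*δ)
    have d1' : HasDerivAt (fun ξ => (m^2+ξ^2) * iteratedDeriv (l+2) (gg m δ) ξ
      + 2 * (l+1) * (ξ * iteratedDeriv (l+1) (gg m δ) ξ)
      + l * (l+1) * iteratedDeriv l (gg m δ) ξ) _ ξ := d1
    rw [e] at d1'
    have := d1'.unique d2
    simp only [show l + 1 + 2 = l + 2 + 1 by ring, show l + 1 + 1 = l + 2 by ring] at this ⊢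
    push_cast
    linarith

lemma gg_bd (m δ : ℝ) (hm : 0 < m) (hδ0 : 0 ≤ δ) (hδ1 : δ < 1) (ξ : ℝ) (l : ℕ) :
    |iteratedDeriv l (gg m δ) ξ| * (Real.sqrt (m^2+ξ^2))^l ≤ 3^l * l.factorial * gg m δ ξ := by
  have hq := q_pos m ξ hm
  set w := Real.sqrt (m^2+ξ^2) with hw
  have hw0 : 0 < w := Real.sqrt_pos.2 hq
  have hw2 : w^2 = m^2+ξ^2 := Real.sq_sqrt hq.le
  have hg := gg_pos m δ ξ hm
  have hξ : |ξ| ≤ w := Real.abs_le_sqrt (by nlinarith)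
  induction l using Nat.twoStepInduction with
  | zero => simp [abs_of_pos hg]
  | one =>
    have h := gg_rec0 m δ hm ξ
    rw [← hw2] at h
    have h1 : w * (w * |iteratedDeriv 1 (gg m δ) ξ|) ≤ w * (3 * gg m δ ξ) := by
      calc w * (w * |iteratedDeriv 1 (gg m δ) ξ|) = |w^2 * iteratedDeriv 1 (gg m δ) ξ| := by
            rw [abs_mul, abs_of_pos (by positivity : 0 < w^2)]; ring
        _ = 2 * δ * |ξ| * gg m δ ξ := by
            rw [h, abs_mul, abs_mul, abs_of_pos hg, abs_of_nonneg (by positivity)]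
        _ ≤ 3 * w * gg m δ ξ := by gcongr; linarith
        _ = _ := by ring
    have := le_of_mul_le_mul_left h1 hw0
    rw [iteratedDeriv_one] at this
    simp; linarith
  | more l h0 h1 =>
    have h := gg_rec m δ hm l ξ
    rw [← hw2] at h
    set a0 := iteratedDeriv l (gg m δ) ξ
    set a1 := iteratedDeriv (l+1) (gg m δ) ξ
    set a2 := iteratedDeriv (l+2) (gg m δ) ξ
    have e : w^2 * a2 = -(2 * (l+1-δ)) * (ξ * a1) + (l+1) * (2*δ - l) * a0 := by linarith
    have hl : (0:ℝ) ≤ l := by positivity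
    have b1 : w^2 * |a2| ≤ 2*(l+2) * (w * |a1|) + (l+1)*(l+2) * |a0| := by
      calc w^2 * |a2| = |w^2 * a2| := by rw [abs_mul, abs_of_pos (by positivity : 0 < w^2)]
        _ ≤ |2 * (l+1-δ)| * (|ξ| * |a1|) + ((l+1) * |2*δ - l|) * |a0| := by
            rw [e]
            refine (abs_add_le _ _).trans (le_of_eq ?_)
            rw [abs_mul, abs_neg, abs_mul ξ, abs_mul _ a0, abs_mul ((l:ℝ)+1), abs_of_nonneg (by positivity : (0:ℝ) ≤ l+1)]
        _ ≤ _ := by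
            gcongr
            · rw [abs_le]; constructor <;> linarith
            · rw [abs_le]; constructor <;> linarith
    have f1 : ((l+1).factorial : ℝ) = (l+1) * l.factorial := by push_cast [Nat.factorial_succ]; ring
    have f2 : ((l+2).factorial : ℝ) = (l+2) * ((l+1) * l.factorial) := by push_cast [Nat.factorial_succ]; ring
    rw [f1] at h1
    rw [f2]
    calc |a2| * w^(l+2) = w^l * (w^2 * |a2|) := by ring
      _ ≤ w^l * (2*(l+2) * (w * |a1|) + (l+1)*(l+2) * |a0|) := by gcongr
      _ = 2*(l+2) * (|a1| * w^(l+1)) + (l+1)*(l+2) * (|a0| * w^l) := by ring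
      _ ≤ 2*(l+2) * (3^(l+1) * ((l+1) * l.factorial) * gg m δ ξ) + (l+1)*(l+2) * (3^l * l.factorial * gg m δ ξ) := by gcongr
      _ = 7 * (3^l * ((l+2) * ((l+1) * l.factorial)) * gg m δ ξ) := by ring
      _ ≤ 9 * (3^l * ((l+2) * ((l+1) * l.factorial)) * gg m δ ξ) := by gcongr; norm_num
      _ = _ := by ring

/-- Glaeser's inequality -/
lemma glaeser (a : ℝ → ℝ) (ha : ContDiff ℝ ∞ a) (ha0 : ∀ x, 0 ≤ a x) (M : ℝ) (hM : 0 < M)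
    (h2 : ∀ x, |iteratedDeriv 2 a x| ≤ M) (x : ℝ) : (iteratedDeriv 1 a x)^2 ≤ 4 * M * a x := by
  have hd : ∀ n x, HasDerivAt (iteratedDeriv n a) (iteratedDeriv (n+1) a x) x := by
    intro n x
    rw [iteratedDeriv_succ]
    have : ContDiff ℝ (n+1 : ℕ) a := ha.of_le (by exact_mod_cast le_top)
    exact ((this.differentiable_iteratedDeriv n (by exact_mod_cast Nat.lt_succ_self n)) x).hasDerivAt
  set p := iteratedDeriv 1 a x with hp
  have lip : ∀ y, |iteratedDeriv 1 a y - p| ≤ M * |y - x| := fun y => by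
    have := convex_univ.norm_image_sub_le_of_norm_hasDerivWithin_le (f := iteratedDeriv 1 a)
      (f' := iteratedDeriv 2 a) (C := M) (x := x) (y := y) (fun z _ => (hd 1 z).hasDerivWithinAt)
      (fun z _ => h2 z) (mem_univ _) (mem_univ _)
    rw [Real.norm_eq_abs, Real.norm_eq_abs] at this
    exact this
  have tay : ∀ h, |a (x+h) - a x - p * h| ≤ M * h^2 := fun h => by
    have hder : ∀ z ∈ Metric.closedBall x |h|,
        HasDerivWithinAt (fun z => a z - p * z) (iteratedDeriv 1 a z - p) (Metric.closedBall x |h|) z := by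
      intro z _
      have h0 := hd 0 z
      rw [iteratedDeriv_zero] at h0
      have := h0.sub ((hasDerivAt_id' z).const_mul p)
      simp only [mul_one, zero_add] at this
      exact this.hasDerivWithinAt
    have := (convex_closedBall x |h|).norm_image_sub_le_of_norm_hasDerivWithin_le (C := M * |h|)
      (x := x) (y := x + h) hder
      (fun z hz => by
        refine (lip z).trans ?_
        have : |z - x| ≤ |h| := by simpa [Real.dist_eq] using hz
        gcongr) (by simp) (by simp)
    simp only [Real.norm_eq_abs, add_sub_cancel_left] at this
    have e : M * |h| * |h| = M * h^2 := by rw [mul_assoc, ← sq, sq_abs]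
    rw [e] at this
    convert this using 2
    ring
  have := (abs_le.1 (tay (-p/(2*M)))).2
  have h3 := ha0 (x + -p/(2*M))
  have h4 : 0 ≤ a x + p * (-p/(2*M)) + M * (-p/(2*M))^2 := by linarith
  have h5 : a x + p * (-p/(2*M)) + M * (-p/(2*M))^2 = (4 * M * a x - p^2) / (4*M) := by
    field_simp; ring
  rw [h5] at h4
  have h6 : 0 ≤ 4 * M * a x - p^2 := by
    have := mul_nonneg h4 (by positivity : 0 ≤ 4*M)
    rwa [div_mul_cancel₀ _ (by positivity)] at this
  linarith

lemma fact_bd (n N : ℕ) (h : n ≤ N) : ((n+2).factorial : ℝ) ≤ 4^(n+2) * (N:ℝ)^n := by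
  have h1 : n.factorial ≤ N^n := (Nat.factorial_le_pow n).trans (Nat.pow_le_pow_left h n)
  have h2 : (n+2) * (n+1) ≤ 4^(n+2) := by
    have a1 : n+2 ≤ 2^(n+2) := Nat.lt_two_pow_self.le
    have a2 : n+1 ≤ 2^(n+2) := by omega
    calc (n+2)*(n+1) ≤ 2^(n+2) * 2^(n+2) := Nat.mul_le_mul a1 a2
      _ = 4^(n+2) := by rw [← mul_pow]; norm_num
  have : (n+2).factorial ≤ 4^(n+2) * N^n := by
    calc (n+2).factorial = ((n+2)*(n+1)) * n.factorial := by
          rw [Nat.factorial_succ, Nat.factorial_succ]; ring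
      _ ≤ _ := Nat.mul_le_mul h2 h1
  exact_mod_cast this

lemma a_bd (s : ℝ) (hs : 1 < s) (a : ℝ → ℝ) (ha : Gevrey s a) (ha0 : ∀ x, 0 ≤ a x) :
    ∃ C A : ℝ, 1 ≤ C ∧ 1 ≤ A ∧ ∀ (v : ℝ), 1 ≤ v → ∀ (N k : ℕ), k ≤ N → ∀ x,
      |iteratedDeriv k a x| * v^2 ≤
        C * A^k * k.factorial * (1 + (N:ℝ)^(s-1) * v⁻¹)^k * v^k * (1 + a x * v^2) := by
  obtain ⟨hsm, C₀, A₀, hC0, hA0, hG⟩ := ha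
  set M := C₀ * A₀^2 * ((2:ℕ).factorial : ℝ)^s with hM
  have hMpos : 0 < M := by positivity
  have hgl := glaeser a hsm ha0 M hMpos (fun x => hG x 2)
  set B := (4:ℝ)^(s-1) with hB
  have hB0 : 0 < B := by positivity
  refine ⟨1 + C₀ + 4*M, 1 + A₀ * B, by linarith, by nlinarith [mul_pos hA0 hB0], ?_⟩
  intro v hv N k hk x
  have hv0 : 0 < v := by linarith
  set R := (N:ℝ)^(s-1) with hR
  have hR0 : 0 ≤ R := by positivity
  set P := 1 + R * v⁻¹ with hP
  have hP1 : 1 ≤ P := by have : 0 ≤ R * v⁻¹ := by positivity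
                         linarith
  have hax := ha0 x
  have hav : 0 ≤ a x * v^2 := by positivity
  set G := 1 + a x * v^2 with hGd
  have hG1 : 1 ≤ G := by linarith
  have hA1 : 1 ≤ 1 + A₀ * B := by nlinarith [mul_pos hA0 hB0]
  match k, hk with
  | 0, _ =>
    simp only [iteratedDeriv_zero, abs_of_nonneg hax, pow_zero, Nat.factorial_zero, Nat.cast_one, mul_one]
    nlinarith
  | 1, _ =>
    have h1 := hgl x
    simp only [pow_one, Nat.factorial_one, Nat.cast_one, mul_one]
    set p := iteratedDeriv 1 a x
    have h2 : |p| * v ≤ (1 + 4*M) * G := by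
      apply abs_le_of_sq_le_sq' _ (by positivity) |>.2
      calc (|p| * v)^2 = p^2 * v^2 := by rw [mul_pow, sq_abs]
        _ ≤ 4 * M * a x * v^2 := by gcongr
        _ = 4 * M * (a x * v^2) := by ring
        _ ≤ 4 * M * G := by gcongr; linarith
        _ ≤ (1 + 4*M)^2 * G^2 := by
          have : 4 * M ≤ (1+4*M)^2 := by nlinarith
          have : G ≤ G^2 := by nlinarith
          gcongr
        _ = _ := by ring
    calc |p| * v^2 = (|p| * v) * v := by ring
      _ ≤ ((1 + 4*M) * G) * v := by gcongr
      _ = (1 + 4*M) * 1 * 1 * v * G := by ring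
      _ ≤ _ := by gcongr; linarith
  | n+2, hk =>
    have h1 := hG x (n+2)
    have hf := fact_bd n N (by omega)
    have hf2 : ((n+2).factorial : ℝ)^(s-1) ≤ B^(n+2) * R^n := by
      calc ((n+2).factorial : ℝ)^(s-1) ≤ (4^(n+2) * (N:ℝ)^n)^(s-1) :=
            Real.rpow_le_rpow (by positivity) hf (by linarith)
        _ = _ := by
          rw [Real.mul_rpow (by positivity) (by positivity), hB, hR,
            Real.rpow_pow_comm (by norm_num), Real.rpow_pow_comm (by positivity)]
    have hf3 : ((n+2).factorial : ℝ)^s = (n+2).factorial * ((n+2).factorial : ℝ)^(s-1) := by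
      have : (0:ℝ) < (n+2).factorial := by positivity
      rw [Real.rpow_sub_one this.ne']; field_simp
    rw [hf3] at h1
    have hPR : R^n ≤ P^(n+2) * v^n := by
      calc R^n = (R * v⁻¹)^n * v^n := by rw [← mul_pow]; congr 1; field_simp
        _ ≤ P^n * v^n := by gcongr; linarith
        _ ≤ _ := by gcongr; omega
    calc _ ≤ (C₀ * A₀^(n+2) * ((n+2).factorial * (B^(n+2) * R^n))) * v^2 := by
          gcongr; exact h1.trans (by gcongr)
      _ ≤ (C₀ * A₀^(n+2) * ((n+2).factorial * (B^(n+2) * (P^(n+2) * v^n)))) * v^2 := by gcongr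
      _ = C₀ * (A₀*B)^(n+2) * (n+2).factorial * P^(n+2) * v^(n+2) * 1 := by ring
      _ ≤ _ := by gcongr <;> linarith

lemma br_pow (μ δ ξ : ℝ) (hμ : 0 < μ) : br μ ξ ^ (2*δ) = gg μ⁻¹ δ ξ := by
  unfold br gg
  rw [Real.sqrt_eq_rpow, ← Real.rpow_mul (by positivity)]
  congr 1; ring

theorem stmt9 (T : ℝ) (hT : 0 < T)
    (b : ℝ → ℝ) (hb : ContDiffOn ℝ 1 b (Icc 0 T)) (hb0 : ∀ t ∈ Icc (0:ℝ) T, 0 ≤ b t)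
    (s δ : ℝ) (hs : 1 < s) (hδ0 : 0 ≤ δ) (hδ1 : δ < 1)
    (a : ℝ → ℝ) (ha : Gevrey s a) (ha0 : ∀ x, 0 ≤ a x) :
    ∃ A C : ℝ, 0 < A ∧ 0 < C ∧
      ∀ (k l : ℕ) (μ t x ξ : ℝ), 0 < μ → μ ≤ 1 → t ∈ Icc (0:ℝ) T →
        |pdXxi k l (fun x' ξ' => dtLam b a T δ μ t x' ξ') x ξ| ≤
          C * A ^ (k + l) * ((k + l).factorial : ℝ) *
            (1 + ((k + l : ℕ) : ℝ) ^ (s - 1) * br μ ξ ^ (-δ)) ^ (k + l) *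
            dtLam b a T δ μ t x ξ * br μ ξ ^ (-(l : ℝ) + δ * (k : ℝ)) := by
  obtain ⟨C, A, hC, hA, hbd⟩ := a_bd s hs a ha ha0
  refine ⟨24 * A * C, 1, by positivity, one_pos, ?_⟩
  intro k l μ t x ξ hμ hμ1 ht
  have hm : 0 < μ⁻¹ := by positivity
  have hm1 : 1 ≤ μ⁻¹ := (one_le_inv₀ hμ).2 hμ1
  have hbt := hb0 t ht
  set m := μ⁻¹ with hmd
  set β := |derivWithin b (Icc 0 T) t| with hβ
  have hβ0 : 0 ≤ β := abs_nonneg _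
  -- the function G and F
  set G : ℝ → ℝ → ℝ := fun x ξ => 1 + a x * gg m δ ξ with hG
  have hGpos : ∀ x ξ, 0 < G x ξ := fun x ξ => by
    have := mul_nonneg (ha0 x) (gg_pos m δ ξ hm).le
    simp only [hG]; linarith
  have hDpos : ∀ x ξ, 0 < 1 + b t * G x ξ := fun x ξ => by
    have := mul_nonneg hbt (hGpos x ξ).le
    linarith
  set F : ℝ → ℝ → ℝ := fun x ξ => G x ξ / (1 + b t * G x ξ) with hF
  have hbrpos : ∀ ξ, 0 < br μ ξ := fun ξ => Real.sqrt_pos.2 (q_pos m ξ hm)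
  have hdt : ∀ x ξ, dtLam b a T δ μ t x ξ = β * F x ξ := fun x ξ => by
    have hg := gg_pos m δ ξ hm
    have hD := hDpos x ξ
    have e : br μ ξ ^ (-(2*δ)) = (gg m δ ξ)⁻¹ := by
      rw [Real.rpow_neg (hbrpos ξ).le, br_pow μ δ ξ hμ]
    have e2 : phi a δ μ x ξ = G x ξ * (gg m δ ξ)⁻¹ := by
      rw [phi, e]; simp only [hG]; field_simp; ring
    rw [dtLam, e2, e, ← hβ]
    have e3 : b t * (G x ξ * (gg m δ ξ)⁻¹) + (gg m δ ξ)⁻¹ = (1 + b t * G x ξ) * (gg m δ ξ)⁻¹ := by ring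
    rw [e3]
    simp only [hF]
    field_simp
  have hGs : ContDiff ℝ ∞ (fun p : ℝ × ℝ => G p.1 p.2) :=
    contDiff_const.add ((ha.1.comp contDiff_fst).mul ((gg_smooth m δ hm).comp contDiff_snd))
  have hFs : ContDiff ℝ ∞ (fun p : ℝ × ℝ => F p.1 p.2) :=
    hGs.div (contDiff_const.add (contDiff_const.mul hGs)) fun p => (hDpos p.1 p.2).ne'
  have hFGs : ContDiff ℝ ∞ (fun p : ℝ × ℝ => b t * (F p.1 p.2 * G p.1 p.2)) :=
    contDiff_const.mul (hFs.mul hGs)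
  have hrel : G = fun x ξ => F x ξ + b t * (F x ξ * G x ξ) := by
    funext x ξ
    have hD := (hDpos x ξ).ne'
    have : F x ξ * (1 + b t * G x ξ) = G x ξ := div_mul_cancel₀ _ hD
    linarith
  set w := br μ ξ with hw
  have hw0 : 0 < w := hbrpos ξ
  have hw1 : 1 ≤ w := by
    rw [hw, br, Real.one_le_sqrt]
    nlinarith [sq_nonneg ξ]
  set v := w^δ with hv
  have hv1 : 1 ≤ v := Real.one_le_rpow hw1 hδ0
  have hv2 : gg m δ ξ = v^2 := by
    rw [← br_pow μ δ ξ hμ, ← hw, hv, ← Real.rpow_natCast, ← Real.rpow_mul hw0.le]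
    congr 1; push_cast; ring
  set P := 1 + ((k+l : ℕ):ℝ)^(s-1) * v⁻¹ with hP
  have hP1 : 1 ≤ P := by
    have : 0 ≤ ((k+l : ℕ):ℝ)^(s-1) * v⁻¹ := by positivity
    linarith
  have key := rec_bd (fun i j => pdXxi i j F x ξ) (fun i j => pdXxi i j G x ξ) (b t) C
    (A * P * v) (3 / w) (k+l) hbt hC (by positivity) (by positivity)
    (by simp only [pdXxi, iteratedDeriv_zero]; exact div_pos (hGpos x ξ) (hDpos x ξ))
    (by simp only [pdXxi, iteratedDeriv_zero]; exact hGpos x ξ)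
    (by
      intro i j hij
      have e0 : pdXxi 0 0 G x ξ = G x ξ := by simp [pdXxi]
      simp only [e0]
      rcases Nat.eq_zero_or_pos (i+j) with h0 | h0
      · obtain ⟨rfl, rfl⟩ : i = 0 ∧ j = 0 := by omega
        rw [e0, abs_of_pos (hGpos x ξ)]
        simp only [pow_zero, Nat.factorial_zero, Nat.cast_one, mul_one]
        nlinarith [hGpos x ξ]
      · rw [hG, pd_one_add a (gg m δ) i j x ξ h0, abs_mul]
        have h1 := hbd v hv1 (k+l) i (by omega) x
        have h2 := gg_bd m δ hm hδ0 hδ1 ξ j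
        have hww : Real.sqrt (m^2+ξ^2) = w := rfl
        rw [hww, hv2] at h2
        rw [← hP] at h1
        have h2' : |iteratedDeriv j (gg m δ) ξ| ≤ 3^j * j.factorial * v^2 / w^j := by
          rw [le_div_iff₀ (by positivity)]; exact h2
        simp only [hv2]
        calc _ ≤ |iteratedDeriv i a x| * (3^j * j.factorial * v^2 / w^j) := by gcongr
          _ = (|iteratedDeriv i a x| * v^2) * (3^j * j.factorial / w^j) := by ring
          _ ≤ (C * A^i * i.factorial * P^i * v^i * (1 + a x * v^2)) * (3^j * j.factorial / w^j) := by gcongr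
          _ = _ := by rw [mul_pow, mul_pow, div_pow]; ring)
    (by
      intro k l
      conv_rhs => rw [hrel]
      rw [pd_add F (fun x ξ => b t * (F x ξ * G x ξ)) hFs hFGs, pd_const_mul, pd_mul F G hFs hGs])
    k l le_rfl
  have e0 : pdXxi 0 0 F x ξ = F x ξ := by simp [pdXxi]
  simp only [e0] at key
  have hF0 : 0 < F x ξ := div_pos (hGpos x ξ) (hDpos x ξ)
  have e1 : (fun x' ξ' => dtLam b a T δ μ t x' ξ') = fun x' ξ' => β * F x' ξ' := by
    funext x' ξ'; exact hdt x' ξ'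
  have e2 : w^(-δ) = v⁻¹ := Real.rpow_neg hw0.le δ
  have e3 : w^(-(l:ℝ) + δ * (k:ℝ)) = v^k / w^l := by
    rw [Real.rpow_add hw0, Real.rpow_neg hw0.le, Real.rpow_natCast, Real.rpow_mul hw0.le,
      Real.rpow_natCast, ← hv]
    field_simp
  have hfac : ((k.factorial : ℝ) * l.factorial) ≤ (k+l).factorial := by
    exact_mod_cast Nat.le_of_dvd (Nat.factorial_pos _) (Nat.factorial_mul_factorial_dvd_factorial_add k l)
  rw [e1, pd_const_mul, hdt, e2, e3, abs_mul, abs_of_nonneg hβ0, ← hP]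
  calc β * |pdXxi k l F x ξ| ≤ β * ((A * P * v)^k * (3/w)^l * (8*C)^(k+l) * (k.factorial * l.factorial) * F x ξ) := by gcongr
    _ = A^k * 3^l * (8*C)^(k+l) * (k.factorial * l.factorial) * P^k * (β * F x ξ) * (v^k / w^l) := by
        rw [mul_pow, mul_pow, div_pow]; ring
    _ ≤ A^(k+l) * 3^(k+l) * (8*C)^(k+l) * (k+l).factorial * P^(k+l) * (β * F x ξ) * (v^k / w^l) := by
        have q1 : A^k ≤ A^(k+l) := pow_le_pow_right₀ hA (by omega)
        have q2 : (3:ℝ)^l ≤ 3^(k+l) := pow_le_pow_right₀ (by norm_num) (by omega)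
        have q3 : P^k ≤ P^(k+l) := pow_le_pow_right₀ hP1 (by omega)
        gcongr
    _ = _ := by
        rw [← mul_pow, ← mul_pow]; ring
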